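/- Let n ≥ 1, ε > 0, and let p⁰ be the maximally mixed computation-register state on Fin 2^n (p^0_i = 2^{-n} for all i), with p^{t+1} = PPA(p^t). Then for every iteration t ∈ ℕ and every index i with 0 ≤ i ≤ 2^n − 2, one has p^t_i / p^t_{i+1} ≤ e^{2ε}. -/

import Mathlib

open Real Filter

/-- The multiset of `2^(n+1)` joint probabilities `p i * e^±ε / z`,
sorted in decreasing order (as a list, largest first):
entry `j` of this list is `λ_{j+1}` in the 1-indexed notation of the paper. -/
noncomputable def ppaSorted (n : ℕ) (ε : ℝ) (p : Fin (2^n) → ℝ) : List ℝ :=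
  ((((Finset.univ : Finset (Fin (2^n))).val.map
      fun j => p j * Real.exp ε / (Real.exp ε + Real.exp (-ε))) +
    ((Finset.univ : Finset (Fin (2^n))).val.map
      fun j => p j * Real.exp (-ε) / (Real.exp ε + Real.exp (-ε)))).sort (· ≤ ·)).reverse

/-- One iteration of the Partner Pairing Algorithm with a reset qubit of
polarization ε: `p'_i = λ_{2i+1} + λ_{2i+2}` (1-indexed) of the sorted joint probabilities. -/
noncomputable def PPA (n : ℕ) (ε : ℝ) (p : Fin (2^n) → ℝ) : Fin (2^n) → ℝ :=
  fun i => (ppaSorted n ε p).getD (2 * (i : ℕ)) 0 + (ppaSorted n ε p).getD (2 * (i : ℕ) + 1) 0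

/-- A computation-register state: strictly positive entries, sorted in
decreasing order, summing to 1. -/
def IsCompState (n : ℕ) (p : Fin (2^n) → ℝ) : Prop :=
  (∀ i, 0 < p i) ∧ Antitone p ∧ ∑ i, p i = 1

/-- In a decreasing list, the entry at position `k` is at least `c` exactly when more than `k`
entries are at least `c`. -/
lemma le_getElem_iff_lt_countP_of_pairwise_ge {l : List ℝ} (hl : l.Pairwise (· ≥ ·)) (c : ℝ) (k : ℕ)
    (hk : k < l.length) : c ≤ l[k] ↔ k < l.countP (fun x => decide (c ≤ x)) := by
  induction l generalizing k with
  | nil => simp at hk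
  | cons a l ih =>
    rw [List.pairwise_cons] at hl
    by_cases hca : c ≤ a
    · cases k with
      | zero => simp [hca]
      | succ k =>
        have := ih hl.2 k (by simpa using hk)
        simp [hca, this]
    · have hall : ∀ x ∈ l, ¬ c ≤ x := fun x hx hcx => hca (hcx.trans (hl.1 x hx))
      have hcount : (a :: l).countP (fun x => decide (c ≤ x)) = 0 := by
        simpa [List.countP_eq_zero] using ⟨lt_of_not_ge hca, fun x hx => lt_of_not_ge (hall x hx)⟩
      rw [hcount]
      refine iff_of_false (fun h => ?_) (Nat.not_lt_zero k)
      rcases List.mem_cons.1 (List.getElem_mem hk) with h' | h'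
      · exact hca (h' ▸ h)
      · exact hall _ h' h

/-- If adjacent ratios of a positive decreasing sequence are at most `r`, then scaling by `r`
brings at least one further entry above any threshold already reached, unless all are above. -/
lemma min_card_superlevel_le_card_scaled_superlevel {N : ℕ} {r : ℝ} (hr : 1 ≤ r) {q : Fin N → ℝ}
    (hpos : ∀ i, 0 < q i) (hanti : Antitone q)
    (hratio : ∀ i j : Fin N, (j : ℕ) = i + 1 → q i ≤ r * q j) (v : ℝ)
    (hne : 0 < (Finset.univ.filter fun i => v ≤ q i).card) :
    min N ((Finset.univ.filter fun i => v ≤ q i).card + 1) ≤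
      (Finset.univ.filter fun i => v ≤ r * q i).card := by
  classical
  have hsub : (Finset.univ.filter fun i => v ≤ q i) ⊆ Finset.univ.filter fun i => v ≤ r * q i :=
    Finset.monotone_filter_right _ fun i _ h => h.trans (le_mul_of_one_le_left (hpos i).le hr)
  obtain ⟨i₀, hi₀⟩ := Finset.card_pos.1 hne
  have hi₀ : v ≤ q i₀ := by simpa using hi₀
  by_cases hex : ∃ m : ℕ, ∃ h : m < N, q ⟨m, h⟩ < v
  · obtain ⟨hm, hlt⟩ := Nat.find_spec hex
    have hm0 : Nat.find hex ≠ 0 := fun h0 => by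
      have : q i₀ ≤ q ⟨Nat.find hex, hm⟩ := hanti (by simp [Fin.le_def, h0])
      linarith
    obtain ⟨m, hmeq⟩ := Nat.exists_eq_succ_of_ne_zero hm0
    have hprev : v ≤ q ⟨m, by omega⟩ := by
      have := Nat.find_min hex (m := m) (by omega)
      push Not at this
      exact this _
    have hstep := hratio ⟨m, by omega⟩ ⟨m + 1, by omega⟩ rfl
    simp only [hmeq] at hlt
    refine (min_le_right _ _).trans (Finset.card_lt_card ?_)
    refine Finset.ssubset_iff_subset_ne.2 ⟨hsub, fun heq => ?_⟩
    have hmem : (⟨m + 1, by omega⟩ : Fin N) ∈ Finset.univ.filter fun i => v ≤ r * q i := by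
      simpa using hprev.trans hstep
    rw [← heq] at hmem
    simp only [Finset.mem_filter] at hmem
    exact absurd hmem.2 (not_le.2 hlt)
  · push Not at hex
    refine (min_le_left _ _).trans ?_
    rw [Finset.filter_true_of_mem]
    · simp
    · exact fun i _ => (hex i i.2).trans (le_mul_of_one_le_left (hpos i).le hr)

lemma ppaSorted_pairwise (n : ℕ) (ε : ℝ) (p : Fin (2^n) → ℝ) :
    (ppaSorted n ε p).Pairwise (· ≥ ·) := by
  rw [ppaSorted, List.pairwise_reverse]
  exact Multiset.pairwise_sort _ _

lemma length_ppaSorted (n : ℕ) (ε : ℝ) (p : Fin (2^n) → ℝ) :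
    (ppaSorted n ε p).length = 2 * 2^n := by
  simp [ppaSorted, two_mul]

lemma countP_ppaSorted (n : ℕ) (ε : ℝ) (p : Fin (2^n) → ℝ) (c : ℝ) :
    (ppaSorted n ε p).countP (fun x => decide (c ≤ x)) =
      (Finset.univ.filter fun i =>
        c ≤ p i * Real.exp ε / (Real.exp ε + Real.exp (-ε))).card +
      (Finset.univ.filter fun i =>
        c ≤ p i * Real.exp (-ε) / (Real.exp ε + Real.exp (-ε))).card := by
  rw [ppaSorted, List.countP_reverse, ← Multiset.coe_countP, Multiset.sort_eq,
    Multiset.countP_add, Multiset.countP_map, Multiset.countP_map]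
  rfl

lemma ppaSorted_getElem_pos {n : ℕ} {ε : ℝ} {p : Fin (2^n) → ℝ} (hpos : ∀ i, 0 < p i) (k : ℕ)
    (hk : k < (ppaSorted n ε p).length) : 0 < (ppaSorted n ε p)[k] := by
  have hmem := List.getElem_mem hk
  generalize (ppaSorted n ε p)[k] = x at hmem
  simp only [ppaSorted, List.mem_reverse, Multiset.mem_sort, Multiset.mem_add,
    Multiset.mem_map] at hmem
  rcases hmem with ⟨i, -, rfl⟩ | ⟨i, -, rfl⟩ <;> have := hpos i <;> positivity

/-- If adjacent ratios of `p` are at most `exp (2 * ε)`, then so are the ratios of entries of the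
sorted joint distribution that are two positions apart. -/
lemma ppaSorted_getElem_le_exp_mul {n : ℕ} (hn : 1 ≤ n) {ε : ℝ} (hε : 0 < ε) {p : Fin (2^n) → ℝ}
    (hpos : ∀ i, 0 < p i) (hanti : Antitone p)
    (hratio : ∀ i j : Fin (2^n), (j : ℕ) = i + 1 → p i ≤ Real.exp (2 * ε) * p j)
    (k : ℕ) (hk : k + 2 < (ppaSorted n ε p).length) :
    (ppaSorted n ε p)[k] ≤ Real.exp (2 * ε) * (ppaSorted n ε p)[k + 2] := by
  have hr : 1 ≤ Real.exp (2 * ε) := Real.one_le_exp (by positivity)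
  have hscale : ∀ c : ℝ, 0 < c → ∀ v : ℝ,
      0 < (Finset.univ.filter fun i => v ≤ p i * c).card →
      min (2^n) ((Finset.univ.filter fun i => v ≤ p i * c).card + 1) ≤
        (Finset.univ.filter fun i => v ≤ Real.exp (2 * ε) * (p i * c)).card := fun c hc v =>
    min_card_superlevel_le_card_scaled_superlevel hr (fun i => mul_pos (hpos i) hc)
      (fun i j hij => mul_le_mul_of_nonneg_right (hanti hij) hc.le)
      (fun i j hij => by
        have := mul_le_mul_of_nonneg_right (hratio i j hij) hc.le
        linarith) v
  have hz : 0 < Real.exp ε + Real.exp (-ε) := by positivity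
  set v := (ppaSorted n ε p)[k]
  have hlow := (le_getElem_iff_lt_countP_of_pairwise_ge (ppaSorted_pairwise n ε p) v k
    (by omega)).1 le_rfl
  rw [← div_le_iff₀' (Real.exp_pos _),
    le_getElem_iff_lt_countP_of_pairwise_ge (ppaSorted_pairwise n ε p)]
  rw [countP_ppaSorted] at hlow ⊢
  rw [length_ppaSorted] at hk
  simp only [div_le_iff₀' (Real.exp_pos (2 * ε)), mul_div_assoc] at hlow ⊢
  have hexp : Real.exp (2 * ε) * (Real.exp (-ε) / (Real.exp ε + Real.exp (-ε))) =
      Real.exp ε / (Real.exp ε + Real.exp (-ε)) := by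
    rw [← mul_div_assoc, ← Real.exp_add]
    ring_nf
  have hA := hscale _ (div_pos (Real.exp_pos ε) hz) v
  have hB := hscale _ (div_pos (Real.exp_pos (-ε)) hz) v
  have hcomm : ∀ i, Real.exp (2 * ε) * (p i * (Real.exp (-ε) / (Real.exp ε + Real.exp (-ε)))) =
      p i * (Real.exp ε / (Real.exp ε + Real.exp (-ε))) := fun i => by
    rw [mul_left_comm, hexp]
  simp only [hcomm] at hB ⊢
  have hN : 2 ≤ 2^n := by simpa using Nat.pow_le_pow_right (n := 2) (by norm_num) hn
  have hcard : ∀ s : Finset (Fin (2^n)), s.card ≤ 2^n := fun s => by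
    simpa using Finset.card_le_univ s
  have hA' := hcard (Finset.univ.filter fun i =>
    v ≤ p i * (Real.exp ε / (Real.exp ε + Real.exp (-ε))))
  have hB' := hcard (Finset.univ.filter fun i =>
    v ≤ p i * (Real.exp (-ε) / (Real.exp ε + Real.exp (-ε))))
  omega

lemma PPA_apply (n : ℕ) (ε : ℝ) (p : Fin (2^n) → ℝ) (i : Fin (2^n)) :
    PPA n ε p i =
      (ppaSorted n ε p)[2 * (i : ℕ)]'(by rw [length_ppaSorted]; omega) +
      (ppaSorted n ε p)[2 * (i : ℕ) + 1]'(by rw [length_ppaSorted]; omega) := by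
  have := length_ppaSorted n ε p
  rw [PPA, List.getD_eq_getElem _ _ (by omega), List.getD_eq_getElem _ _ (by omega)]

lemma PPA_pos {n : ℕ} {ε : ℝ} {p : Fin (2^n) → ℝ} (hpos : ∀ i, 0 < p i) (i : Fin (2^n)) :
    0 < PPA n ε p i := by
  rw [PPA_apply]
  exact add_pos (ppaSorted_getElem_pos hpos _ _) (ppaSorted_getElem_pos hpos _ _)

lemma PPA_antitone (n : ℕ) (ε : ℝ) (p : Fin (2^n) → ℝ) : Antitone (PPA n ε p) := by
  intro i j hij
  rw [PPA_apply, PPA_apply]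
  have hmono := (ppaSorted_pairwise n ε p).sortedGE.antitone_get
  have hij : (i : ℕ) ≤ j := hij
  exact add_le_add (hmono (Fin.mk_le_mk.2 (by omega))) (hmono (Fin.mk_le_mk.2 (by omega)))

lemma PPA_le_exp_mul {n : ℕ} (hn : 1 ≤ n) {ε : ℝ} (hε : 0 < ε) {p : Fin (2^n) → ℝ}
    (hpos : ∀ i, 0 < p i) (hanti : Antitone p)
    (hratio : ∀ i j : Fin (2^n), (j : ℕ) = i + 1 → p i ≤ Real.exp (2 * ε) * p j)
    (i j : Fin (2^n)) (hij : (j : ℕ) = i + 1) :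
    PPA n ε p i ≤ Real.exp (2 * ε) * PPA n ε p j := by
  rw [PPA_apply, PPA_apply, mul_add]
  simp only [hij]
  have hlen := length_ppaSorted n ε p
  exact add_le_add
    (ppaSorted_getElem_le_exp_mul hn hε hpos hanti hratio (2 * i) (by omega))
    (ppaSorted_getElem_le_exp_mul hn hε hpos hanti hratio (2 * i + 1) (by omega))

/-- starting from the maximally mixed state, for every iteration
`t` and every index `i`, `p^t_i / p^t_{i+1} ≤ e^{2ε}`. -/
theorem ppa_ratio_bound_maximally_mixed (n : ℕ) (hn : 1 ≤ n) (ε : ℝ) (hε : 0 < ε)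
    (p : ℕ → Fin (2^n) → ℝ)
    (h0 : ∀ i, p 0 i = 1 / 2^n)
    (hstep : ∀ t, p (t + 1) = PPA n ε (p t)) :
    ∀ t : ℕ, ∀ i : ℕ, ∀ hi : i + 1 < 2^n,
      p t ⟨i, by omega⟩ / p t ⟨i + 1, hi⟩ ≤ Real.exp (2 * ε) := by
  have hinv : ∀ t, (∀ i, 0 < p t i) ∧ Antitone (p t) ∧
      ∀ i j : Fin (2^n), (j : ℕ) = i + 1 → p t i ≤ Real.exp (2 * ε) * p t j := by
    intro t
    induction t with
    | zero =>
      refine ⟨fun i => ?_, fun i j _ => ?_, fun i j _ => ?_⟩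
      · rw [h0]
        positivity
      · rw [h0, h0]
      · rw [h0, h0]
        exact le_mul_of_one_le_left (by positivity) (Real.one_le_exp (by positivity))
    | succ t ih =>
      obtain ⟨hpos, hanti, hratio⟩ := ih
      rw [hstep]
      exact ⟨PPA_pos hpos, PPA_antitone n ε _, PPA_le_exp_mul hn hε hpos hanti hratio⟩
  intro t i hi
  obtain ⟨hpos, -, hratio⟩ := hinv t
  exact (div_le_iff₀ (hpos _)).2 (hratio _ _ rfl)
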